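/- arXiv:2102.02517 — 2 statements merged into one kernel-verified Lean document; each statement's English description precedes it below -/
import Mathlib

section
/- Let M be a real symmetric positive definite n×n matrix whose off-diagonal entries are all nonpositive (M_{ij} ≤ 0 for i ≠ j). Then every entry of the inverse matrix M^{−1} is nonnegative. -/
/-- A positive definite real matrix with nonpositive off-diagonal entries is inverse-monotone. -/
theorem Matrix.PosDef.nonneg_of_mulVec_nonneg {ι : Type*} [Fintype ι] {M : Matrix ι ι ℝ}
    (hM : M.PosDef) (hoff : ∀ i j, i ≠ j → M i j ≤ 0) {x : ι → ℝ}
    (hx : ∀ i, 0 ≤ (M.mulVec x) i) (i : ι) : 0 ≤ x i := by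
  by_contra! hi
  set z : ι → ℝ := fun k => max (-x k) 0 with hz
  have hz0 : ∀ k, 0 ≤ z k := fun k => le_max_right _ _
  have hz_ne : z ≠ 0 := fun h => by
    have h1 : -x i ≤ z i := le_max_left _ _
    rw [h, Pi.zero_apply] at h1
    linarith
  have hpos : 0 < z ⬝ᵥ M.mulVec z := by
    simpa using hM.dotProduct_mulVec_pos hz_ne
  have hnonneg : 0 ≤ z ⬝ᵥ M.mulVec x :=
    Finset.sum_nonneg fun k _ => mul_nonneg (hz0 k) (hx k)
  have hle : z ⬝ᵥ M.mulVec x + z ⬝ᵥ M.mulVec z ≤ 0 := by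
    rw [← dotProduct_add, ← Matrix.mulVec_add]
    simp only [dotProduct, Matrix.mulVec, Finset.mul_sum]
    refine Finset.sum_nonpos fun k _ => Finset.sum_nonpos fun l _ => ?_
    have hl : 0 ≤ (x + z) l := by
      have : -x l ≤ z l := le_max_left _ _
      rw [Pi.add_apply]
      linarith
    rcases eq_or_ne k l with rfl | hkl
    · have : z k * (x + z) k = 0 := by
        rcases le_total (x k) 0 with h | h
        · simp [hz, h]
        · simp [hz, h]
      rw [mul_left_comm, this, mul_zero]
    · exact mul_nonpos_of_nonneg_of_nonpos (hz0 k)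
        (mul_nonpos_of_nonpos_of_nonneg (hoff k l hkl) hl)
  linarith

/-- A real symmetric positive definite matrix with nonpositive off-diagonal entries
has an inverse with nonnegative entries. -/
theorem stmt9 {n : ℕ} (M : Matrix (Fin n) (Fin n) ℝ)
    (hsymm : M.IsSymm) (hpd : M.PosDef)
    (hoff : ∀ i j, i ≠ j → M i j ≤ 0) :
    ∀ i j, 0 ≤ M⁻¹ i j := by
  intro i j
  refine hpd.nonneg_of_mulVec_nonneg hoff (x := fun k => M⁻¹ k j) (fun k => ?_) i
  have h : (M.mulVec fun k => M⁻¹ k j) k = (M * M⁻¹) k j := rfl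
  rw [h, Matrix.mul_nonsing_inv M ((Matrix.isUnit_iff_isUnit_det M).mp hpd.isUnit),
    Matrix.one_apply]
  split_ifs <;> norm_num
end

section
/- Let L be a free ℤ-module of finite rank, let θ be a ℤ-linear automorphism of L, and set V = L ⊗ ℝ, extending θ to V. Assume V = ker(1 − θ) ⊕ (1 − θ)V. Let L^θ = {x ∈ L : θ(x) = x}. Then the composite map L^θ → L → L/(1 − θ)L is injective, and its cokernel is finite of cardinality |det((1 − θ)|_W)|, where W = (1 − θ)V and (1 − θ)|_W is the automorphism of W induced by 1 − θ. -/
open scoped TensorProduct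

section Lattice

variable {N : Type*} [AddCommGroup N] [Module.Free ℤ N] [Module.Finite ℤ N]

/-- The cokernel of an injective endomorphism of a lattice has cardinality `|det|`. -/
theorem LinearMap.card_quotient_range_eq_natAbs_det (f : N →ₗ[ℤ] N)
    (hf : Function.Injective f) :
    Nat.card (N ⧸ LinearMap.range f) = (LinearMap.det f).natAbs := by
  rw [← Submodule.natAbs_det_equiv _ (LinearEquiv.ofInjective f hf)]
  rfl

theorem LinearMap.finite_quotient_range_of_injective (f : N →ₗ[ℤ] N)
    (hf : Function.Injective f) : Finite (N ⧸ LinearMap.range f) := by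
  apply Nat.finite_of_card_ne_zero
  rw [LinearMap.card_quotient_range_eq_natAbs_det f hf, Int.natAbs_ne_zero]
  exact fun h => LinearMap.det_eq_zero_iff_ker_ne_bot.1 h (LinearMap.ker_eq_bot.2 hf)

end Lattice

section Endomorphism

variable {R M : Type*} [CommRing R] [AddCommGroup M] [Module R M]

/-- The restriction of an endomorphism to its range. -/
def LinearMap.restrictRange (f : M →ₗ[R] M) : LinearMap.range f →ₗ[R] LinearMap.range f :=
  f.restrict fun x _ => LinearMap.mem_range_self f x

/-- The cokernel of `ker f → M ⧸ range f` is `range f ⧸ f (range f)`, via `f`. -/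
noncomputable def LinearMap.cokerKerToCokerEquiv (f : M →ₗ[R] M) :
    ((M ⧸ LinearMap.range f) ⧸
        LinearMap.range ((LinearMap.range f).mkQ ∘ₗ (LinearMap.ker f).subtype))
      ≃ₗ[R] LinearMap.range f ⧸ LinearMap.range f.restrictRange :=
  (Submodule.quotEquivOfEq _ _ (by
      rw [LinearMap.range_comp, Submodule.range_subtype])) ≪≫ₗ
  Submodule.quotientQuotientEquivQuotientSup _ _ ≪≫ₗ
  (Submodule.quotEquivOfEq _ _ (by
    ext x
    simp only [Submodule.mem_sup, LinearMap.mem_ker, LinearMap.coe_comp, Function.comp_apply,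
      Submodule.mkQ_apply, Submodule.Quotient.mk_eq_zero]
    constructor
    · rintro ⟨_, ⟨y, rfl⟩, z, hz, rfl⟩
      exact ⟨⟨f y, y, rfl⟩, Subtype.ext (by simp [LinearMap.restrictRange, hz])⟩
    · rintro ⟨⟨_, y, rfl⟩, hy⟩
      refine ⟨f y, ⟨y, rfl⟩, x - f y, ?_, by simp⟩
      rw [map_sub, sub_eq_zero]
      exact (congrArg Subtype.val hy).symm)) ≪≫ₗ
  LinearMap.quotKerEquivOfSurjective ((LinearMap.range f.restrictRange).mkQ ∘ₗ f.rangeRestrict)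
    ((Submodule.mkQ_surjective _).comp f.surjective_rangeRestrict)

variable (A : Type*) [CommRing A] [Algebra R A]

theorem LinearMap.range_baseChange_subtype_range (f : M →ₗ[R] M) :
    LinearMap.range ((LinearMap.range f).subtype.baseChange A) =
      LinearMap.range (f.baseChange A) := by
  have h : f.baseChange A =
      (LinearMap.range f).subtype.baseChange A ∘ₗ f.rangeRestrict.baseChange A := by
    rw [← LinearMap.baseChange_comp]
    rfl
  rw [h, LinearMap.range_comp_of_range_eq_top]
  exact LinearMap.range_eq_top.2 (LinearMap.lTensor_surjective A f.surjective_rangeRestrict)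

theorem LinearMap.det_restrictRange_baseChange [Module.Flat R A] (f : M →ₗ[R] M)
    [Module.Free R (LinearMap.range f)] [Module.Finite R (LinearMap.range f)] :
    LinearMap.det (M := LinearMap.range (f.baseChange A)) (f.baseChange A).restrictRange =
      algebraMap R A (LinearMap.det f.restrictRange) := by
  let e : A ⊗[R] LinearMap.range f ≃ₗ[A] LinearMap.range (f.baseChange A) :=
    LinearEquiv.ofInjective ((LinearMap.range f).subtype.baseChange A)
      (Module.Flat.lTensor_preserves_injective_linearMap _ (Submodule.subtype_injective _)) ≪≫ₗ
    LinearEquiv.ofEq _ _ (f.range_baseChange_subtype_range A)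
  rw [← LinearMap.det_baseChange, ← LinearMap.det_conj (N := LinearMap.range (f.baseChange A))
    (f.restrictRange.baseChange A) e]
  congr 1
  rw [← LinearMap.comp_assoc, LinearEquiv.eq_comp_toLinearMap_symm]
  ext x
  rfl

end Endomorphism

/-- Let `θ` be an automorphism of a free `ℤ`-module `L` of finite rank, `V = ℝ ⊗ L`,
and assume `V = ker(1-θ) ⊕ (1-θ)V`.  Then the composite `L^θ → L → L/(1-θ)L` is
injective with finite cokernel of cardinality `|det((1-θ)|_W)|`, `W = (1-θ)V`. -/
theorem stmt13 {L : Type*} [AddCommGroup L] [Module ℤ L] [Module.Free ℤ L]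
    [Module.Finite ℤ L]
    (θ : L ≃ₗ[ℤ] L) (fL : L →ₗ[ℤ] L) (hfL : fL = LinearMap.id - θ.toLinearMap)
    (fV : ℝ ⊗[ℤ] L →ₗ[ℝ] ℝ ⊗[ℤ] L) (hfV : fV = LinearMap.baseChange ℝ fL)
    (hcompl : IsCompl (LinearMap.ker fV) (LinearMap.range fV))
    (g : ↥(LinearMap.ker fL) →ₗ[ℤ] L ⧸ LinearMap.range fL)
    (hg : g = (LinearMap.range fL).mkQ.comp (LinearMap.ker fL).subtype) :
    Function.Injective ⇑g ∧
      Finite ((L ⧸ LinearMap.range fL) ⧸ LinearMap.range g) ∧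
      (Nat.card ((L ⧸ LinearMap.range fL) ⧸ LinearMap.range g) : ℝ) =
        |LinearMap.det (fV.restrict (p := LinearMap.range fV) (q := LinearMap.range fV)
          (fun x _ => LinearMap.mem_range_self fV x))| := by
  obtain rfl : ‹Module ℤ L› = AddCommGroup.toIntModule L := Subsingleton.elim _ _
  have hdisj : Disjoint (LinearMap.ker fL) (LinearMap.range fL) := by
    rw [Submodule.disjoint_def]
    rintro x hx ⟨y, rfl⟩
    have h0 : (1 : ℝ) ⊗ₜ[ℤ] fL y = 0 :=
      Submodule.disjoint_def.1 hcompl.disjoint _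
        (by rw [hfV, LinearMap.mem_ker, LinearMap.baseChange_tmul, LinearMap.mem_ker.1 hx,
          TensorProduct.tmul_zero])
        ⟨1 ⊗ₜ y, by rw [hfV, LinearMap.baseChange_tmul]⟩
    have hinj := (Module.Flat.rTensor_preserves_injective_linearMap (M := L)
      (Algebra.linearMap ℤ ℝ) Int.cast_injective).comp (TensorProduct.lid ℤ L).symm.injective
    exact hinj (by simpa using h0)
  have hres : Function.Injective fL.restrictRange := by
    rw [injective_iff_map_eq_zero]
    rintro ⟨x, hx⟩ h
    exact Subtype.ext (Submodule.disjoint_def.1 hdisj x (congrArg Subtype.val h) hx)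
  have hfin := fL.restrictRange.finite_quotient_range_of_injective hres
  have hcard := fL.restrictRange.card_quotient_range_eq_natAbs_det hres
  subst hg
  refine ⟨?_, Finite.of_equiv _ fL.cokerKerToCokerEquiv.symm.toEquiv, ?_⟩
  · rw [injective_iff_map_eq_zero]
    rintro ⟨x, hx⟩ h
    exact Subtype.ext (Submodule.disjoint_def.1 hdisj x hx
      ((Submodule.Quotient.mk_eq_zero _).1 h))
  · subst hfV
    refine (congrArg Nat.cast
      ((Nat.card_congr fL.cokerKerToCokerEquiv.toEquiv).trans hcard)).trans ?_
    rw [Nat.cast_natAbs, Int.cast_abs]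
    exact congrArg abs (fL.det_restrictRange_baseChange ℝ).symm
end
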